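/- The set of all Abelian periodic group varieties is definable in the lattice Com. Moreover, a commutative semigroup variety is an Abelian periodic group variety if and only if it does not contain the variety SL of semilattices nor the variety ZM of null semigroups. -/

import Mathlib

open FirstOrder

/-! ### Words, identities, and commutative semigroup varieties -/

/-- Semigroup words over the countable alphabet `ℕ`. -/
abbrev SGWord : Type := FreeSemigroup ℕ

/-- A semigroup identity `u = v` is a pair of words. -/
abbrev SGId : Type := SGWord × SGWord

/-- The one-letter word consisting of the letter `n`. -/
def ltr (n : ℕ) : SGWord := FreeSemigroup.of n

/-- `wpow w n` is the word `w^n` (for `n ≥ 1`; by convention `wpow w 0 = w`). -/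
def wpow (w : SGWord) : ℕ → SGWord
  | 0 => w
  | 1 => w
  | n + 2 => wpow w (n + 1) * w

/-- The letter `n` occurs in the word `w`. -/
def OccursIn (n : ℕ) (w : SGWord) : Prop := n = w.head ∨ n ∈ w.tail

/-- A semigroup `S` satisfies the identity `i.1 = i.2` if all evaluations of the two
words in `S` coincide. -/
def SGSatisfies (S : Type) [Semigroup S] (i : SGId) : Prop :=
  ∀ f : ℕ → S, FreeSemigroup.lift f i.1 = FreeSemigroup.lift f i.2

/-- A bundled (nonempty) commutative semigroup. -/
structure ComSG where
  carrier : Type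
  [str : CommSemigroup carrier]
  [instNonempty : Nonempty carrier]

attribute [instance] ComSG.str ComSG.instNonempty

/-- The class of commutative semigroups satisfying every identity in `E`. -/
def modelsOf (E : Set SGId) : Set ComSG := {S | ∀ i ∈ E, SGSatisfies S.carrier i}

/-- The set of identities holding in every member of the class `K`. -/
def theoryOfClass (K : Set ComSG) : Set SGId := {i | ∀ S ∈ K, SGSatisfies S.carrier i}

theorem subset_theoryOfClass_modelsOf (E : Set SGId) : E ⊆ theoryOfClass (modelsOf E) :=
  fun i hi S hS => hS i hi

theorem theoryOfClass_antitone {K K' : Set ComSG} (h : K ⊆ K') :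
    theoryOfClass K' ⊆ theoryOfClass K := fun _ hi S hS => hi S (h hS)

theorem modelsOf_antitone {E E' : Set SGId} (h : E ⊆ E') : modelsOf E' ⊆ modelsOf E :=
  fun _ hS i hi => hS i (h hi)

/-- A variety of commutative semigroups, identified with its (equationally closed)
equational theory.  Varieties are ordered by inclusion of the corresponding classes
of semigroups, i.e. by *reverse* inclusion of theories. -/
structure ComVariety where
  theory : Set SGId
  closed : theoryOfClass (modelsOf theory) = theory

theorem ComVariety.ext' {V W : ComVariety} (h : V.theory = W.theory) : V = W := by
  cases V; cases W; cases h; rfl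

instance : PartialOrder ComVariety where
  le V W := W.theory ⊆ V.theory
  le_refl V := subset_rfl
  le_trans U V W h1 h2 := fun i hi => h1 (h2 hi)
  le_antisymm V W h1 h2 := ComVariety.ext' (subset_antisymm h2 h1)

instance : SupSet ComVariety where
  sSup s :=
    { theory := ⋂ V ∈ s, V.theory
      closed := by
        apply subset_antisymm
        · intro i hi
          refine Set.mem_iInter₂.2 fun V hV => ?_
          have h1 : (⋂ V ∈ s, ComVariety.theory V) ⊆ V.theory := Set.biInter_subset_of_mem hV
          have h2 := theoryOfClass_antitone (modelsOf_antitone h1)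
          rw [V.closed] at h2
          exact h2 hi
        · exact subset_theoryOfClass_modelsOf _ }

/-- The lattice **Com** of all commutative semigroup varieties. -/
instance : CompleteLattice ComVariety :=
  completeLatticeOfSup ComVariety fun s => by
    constructor
    · intro V hV i hi
      exact Set.mem_iInter₂.1 hi V hV
    · intro W hW i hi
      exact Set.mem_iInter₂.2 fun V hV => hW hV hi

/-- The variety of commutative semigroups given by the identity system `E`. -/
def comVar (E : Set SGId) : ComVariety where
  theory := theoryOfClass (modelsOf E)
  closed := by
    apply subset_antisymm
    · exact theoryOfClass_antitone fun S hS i hi => hi S hS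
    · exact subset_theoryOfClass_modelsOf _

/-! ### The first-order language of lattices and definability -/

/-- The first-order language of lattices: two binary function symbols (`true` for the
join `∨` and `false` for the meet `∧`) and nothing else. -/
def latticeLang : Language where
  Functions := fun n => match n with | 2 => Bool | _ => Empty
  Relations := fun _ => Empty

instance latticeLangStructure (L : Type*) [Lattice L] : latticeLang.Structure L where
  funMap {n} f x :=
    match n, f with
    | 2, b => bif b then x 0 ⊔ x 1 else x 0 ⊓ x 1
    | 0, f => f.elim
    | 1, f => f.elim
    | (_ + 3), f => f.elim
  RelMap {n} r _ := r.elim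

/-- A subset `A` of a lattice `L` is definable in `L` if there is a first-order formula
`φ(x)` with one free variable in the language of the lattice operations `∨` and `∧`
such that for every `a ∈ L`, `φ(a)` holds in `L` if and only if `a ∈ A`. -/
def LatDefinable (L : Type*) [Lattice L] (A : Set L) : Prop :=
  ∃ φ : latticeLang.Formula (Fin 1), ∀ a : L, (φ.Realize fun _ => a) ↔ a ∈ A

/-! ### Named varieties -/

/-- The commutativity identity `xy = yx`. -/
def commId : SGId := (ltr 0 * ltr 1, ltr 1 * ltr 0)

/-- The pair of identities abbreviated by the symbolic identity `w = 0`, namely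
`wx = w` and `xw = w`, where `x` is the letter `n` (assumed not to occur in `w`). -/
def zeroId (w : SGWord) (n : ℕ) : Set SGId := {(w * ltr n, w), (ltr n * w, w)}

/-- `A n = var{xⁿy = y, xy = yx}`, the variety of Abelian groups of exponent dividing `n`. -/
def Avar (n : ℕ) : ComVariety := comVar {(wpow (ltr 0) n * ltr 1, ltr 1), commId}

/-- `SL = var{x² = x, xy = yx}`, the variety of semilattices. -/
def SLvar : ComVariety := comVar {(wpow (ltr 0) 2, ltr 0), commId}

/-- `ZM = var{xy = 0}` (within **Com**), the variety of null semigroups. -/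
def ZMvar : ComVariety := comVar ({commId} ∪ zeroId (ltr 0 * ltr 1) 2)

/-- `T = var{x = y}`, the trivial variety. -/
def Tvar : ComVariety := comVar {(ltr 0, ltr 1)}

/-- `COM`, the variety of all commutative semigroups. -/
def COMvar : ComVariety := comVar {commId}

/-- `C m = var{xᵐ = xᵐ⁺¹, xy = yx}` (the variety generated by the cyclic monoid
`⟨a ∣ aᵐ = aᵐ⁺¹⟩`), with the convention `C 0 = T`. -/
def Cvar : ℕ → ComVariety
  | 0 => Tvar
  | m + 1 => comVar {(wpow (ltr 0) (m + 1), wpow (ltr 0) (m + 2)), commId}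

/-- `D m = var{xᵐ = 0, xy = yx}`. -/
def Dvar (m : ℕ) : ComVariety := comVar ({commId} ∪ zeroId (wpow (ltr 0) m) 1)

/-- The word `x₁x₂⋯x_k` (in the letters `0, 1, …, k-1`), for `k ≥ 1`. -/
def chainWord : ℕ → SGWord
  | 0 => ltr 0
  | 1 => ltr 0
  | k + 2 => chainWord (k + 1) * ltr (k + 1)

/-- `N k = var{x² = x₁x₂⋯x_k = 0, xy = yx}`. -/
def Nvar (k : ℕ) : ComVariety :=
  comVar ({commId} ∪ zeroId (wpow (ltr 0) 2) 1 ∪ zeroId (chainWord k) k)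

/-- `N_ω = var{x² = 0, xy = yx}`. -/
def Nomegavar : ComVariety := comVar ({commId} ∪ zeroId (wpow (ltr 0) 2) 1)

/-- `N₃ᶜ = var{xyz = 0, xy = yx}`. -/
def N3cvar : ComVariety := comVar ({commId} ∪ zeroId (ltr 0 * ltr 1 * ltr 2) 3)

/-! ### Semantic notions -/

/-- A semigroup `S` belongs to the variety `V` if it satisfies every identity of `V`. -/
def VMem (S : Type) [Semigroup S] (V : ComVariety) : Prop :=
  ∀ i ∈ V.theory, SGSatisfies S i

/-- `spow a n` is the power `aⁿ` in a semigroup (for `n ≥ 1`; by convention `spow a 0 = a`). -/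
def spow {S : Type} [Semigroup S] (a : S) : ℕ → S
  | 0 => a
  | 1 => a
  | n + 2 => spow a (n + 1) * a

/-- A semigroup is a group. -/
def IsGroupSG (S : Type) [Semigroup S] : Prop :=
  ∃ e : S, (∀ a, e * a = a ∧ a * e = a) ∧ ∀ a, ∃ b, a * b = e ∧ b * a = e

/-- A semigroup is periodic: every element generates a finite cyclic subsemigroup. -/
def IsPeriodicSG (S : Type) [Semigroup S] : Prop :=
  ∀ a : S, ∃ i j : ℕ, 1 ≤ i ∧ i < j ∧ spow a i = spow a j

/-- A semigroup is a nil-semigroup: it has a zero element and every element has a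
power equal to zero. -/
def IsNilSG (S : Type) [Semigroup S] : Prop :=
  ∃ z : S, (∀ a, z * a = z ∧ a * z = z) ∧ ∀ a, ∃ n, 1 ≤ n ∧ spow a n = z

/-- A variety all of whose members are groups. -/
def IsGroupVariety (V : ComVariety) : Prop := ∀ S ∈ modelsOf V.theory, IsGroupSG S.carrier

/-- A variety all of whose members are periodic semigroups. -/
def IsPeriodicVariety (V : ComVariety) : Prop := ∀ S ∈ modelsOf V.theory, IsPeriodicSG S.carrier

/-- A nil-variety: a variety all of whose members are nil-semigroups. -/
def IsNilVariety (V : ComVariety) : Prop := ∀ S ∈ modelsOf V.theory, IsNilSG S.carrier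

/-- A combinatorial variety: all groups in it are trivial. -/
def IsCombinatorial (V : ComVariety) : Prop :=
  ∀ S ∈ modelsOf V.theory, IsGroupSG S.carrier → ∀ a b : S.carrier, a = b

/-- `K` is the variety generated by the semigroup `M` (with explicit semigroup
structure `inst`): the smallest variety containing `M`. -/
def GeneratedBy (M : Type) (inst : Semigroup M) (K : ComVariety) : Prop :=
  IsLeast {W : ComVariety | ∀ i ∈ W.theory, @SGSatisfies M inst i} K

/-- A neutral element of a lattice. -/
def IsNeutralElt {α : Type*} [Lattice α] (x : α) : Prop :=
  ∀ y z, (x ⊔ y) ⊓ (y ⊔ z) ⊓ (z ⊔ x) = (x ⊓ y) ⊔ (y ⊓ z) ⊔ (z ⊓ x)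

/-- A chain variety: a variety whose lattice of subvarieties is a chain. -/
def IsChainVariety (V : ComVariety) : Prop :=
  ∀ W₁ W₂ : ComVariety, W₁ ≤ V → W₂ ≤ V → W₁ ≤ W₂ ∨ W₂ ≤ W₁

/-- A variety is 0-reduced in **Com** if it is given within `COM` by 0-reduced
identities (identities of the form `w = 0`) only. -/
def IsZeroReduced (V : ComVariety) : Prop :=
  ∃ P : Set (SGWord × ℕ), (∀ p ∈ P, ¬ OccursIn p.2 p.1) ∧
    V = comVar (⋃ p ∈ P, zeroId p.1 p.2)

/-- `ZR V`: the least variety 0-reduced in **Com** that contains `V`. -/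
def ZRv (V : ComVariety) : ComVariety := sInf {W : ComVariety | IsZeroReduced W ∧ V ≤ W}

/-! ### Evaluation of words -/

/-- The list of letters of a word. -/
def letters (u : SGWord) : List ℕ := u.head :: u.tail

theorem letters_ltr (n : ℕ) : letters (ltr n) = [n] := rfl

theorem letters_mul (u v : SGWord) : letters (u * v) = letters u ++ letters v := by
  simp [letters]

theorem letters_wpow_succ (w : ℕ) (n : ℕ) :
    letters (wpow (ltr w) (n + 1)) = List.replicate (n + 1) w := by
  induction n with
  | zero => rfl
  | succ n ih =>
    rw [wpow, letters_mul, ih, letters_ltr, List.replicate_succ' (n := n + 1)]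

theorem lift_eq_prod {M : Type*} [Monoid M] (f : ℕ → M) (u : SGWord) :
    FreeSemigroup.lift f u = ((letters u).map f).prod := by
  induction u using FreeSemigroup.recOnMul with
  | ih1 x => change FreeSemigroup.lift f (FreeSemigroup.of x) = ((letters (ltr x)).map f).prod
             simp [letters_ltr]
  | ih2 x y h1 h2 => rw [map_mul, h1, h2, letters_mul, List.map_append, List.prod_append]

theorem map_lift {S T : Type*} [Semigroup S] [Semigroup T] (φ : S →ₙ* T) (f : ℕ → S)
    (u : SGWord) : φ (FreeSemigroup.lift f u) = FreeSemigroup.lift (fun c => φ (f c)) u := by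
  induction u using FreeSemigroup.recOnMul with
  | ih1 x => simp
  | ih2 x y h1 h2 => rw [map_mul, map_mul, map_mul, h1, h2]

theorem coe_lift {S : Type*} [Semigroup S] (f : ℕ → S) (u : SGWord) :
    ((FreeSemigroup.lift f u : S) : WithOne S) =
      ((letters u).map fun c => (f c : WithOne S)).prod := by
  rw [← lift_eq_prod]
  exact map_lift WithOne.coeMulHom f u

theorem SGSatisfies.prod_eq {S : Type} [Semigroup S] {u v : SGWord} (h : SGSatisfies S (u, v))
    (f : ℕ → S) : ((letters u).map fun c => (f c : WithOne S)).prod =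
      ((letters v).map fun c => (f c : WithOne S)).prod := by
  rw [← coe_lift, ← coe_lift]
  exact congrArg _ (h f)

theorem SGSatisfies.symm {S : Type} [Semigroup S] {u v : SGWord} (h : SGSatisfies S (u, v)) :
    SGSatisfies S (v, u) := fun f => (h f).symm

theorem SGSatisfies.of_injective {S T : Type} [Semigroup S] [Semigroup T] (φ : S →ₙ* T)
    (hφ : Function.Injective φ) {i : SGId} (h : SGSatisfies T i) : SGSatisfies S i := by
  intro f
  apply hφ
  rw [map_lift, map_lift]
  exact h _

theorem satisfies_of_prod_eq {S : Type} [Semigroup S] {u v : SGWord}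
    (h : ∀ f : ℕ → S, ((letters u).map fun c => (f c : WithOne S)).prod =
      ((letters v).map fun c => (f c : WithOne S)).prod) : SGSatisfies S (u, v) := by
  intro f
  apply WithOne.coe_injective
  rw [coe_lift, coe_lift]
  exact h f

theorem satisfies_iff_prod_eq {S : Type} [Monoid S] {u v : SGWord} :
    SGSatisfies S (u, v) ↔
      ∀ f : ℕ → S, ((letters u).map f).prod = ((letters v).map f).prod := by
  simp only [SGSatisfies, lift_eq_prod]

theorem satisfies_commId (S : Type) [CommSemigroup S] : SGSatisfies S commId := by
  intro f
  simp [commId, mul_comm]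

theorem prod_map_ite {M : Type*} [CommMonoid M] (l : List ℕ) (c : ℕ) (a b : M) :
    (l.map fun x => if x = c then a else b).prod =
      a ^ l.count c * b ^ l.countP (fun x => decide (x ≠ c)) := by
  induction l with
  | nil => simp
  | cons x l ih =>
    by_cases h : x = c
    · subst h
      simp [ih, pow_succ', mul_assoc]
    · simp [ih, h, pow_succ', mul_left_comm]

theorem pow_eq_self_of_mul_self {M : Type*} [Monoid M] {a : M} (h : a * a = a) {n : ℕ}
    (hn : n ≠ 0) : a ^ n = a :=
  IsIdempotentElem.pow_eq h hn

theorem exists_coe_eq_pow {S : Type*} [Semigroup S] (a : S) {n : ℕ} (hn : n ≠ 0) :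
    ∃ b : S, (b : WithOne S) = (a : WithOne S) ^ n := by
  obtain ⟨m, rfl⟩ := Nat.exists_eq_succ_of_ne_zero hn
  induction m with
  | zero => exact ⟨a, by simp⟩
  | succ m ih =>
    obtain ⟨b, hb⟩ := ih (by simp)
    exact ⟨b * a, by rw [WithOne.coe_mul, hb, ← pow_succ]⟩

theorem coe_spow_succ {S : Type} [Semigroup S] (a : S) (n : ℕ) :
    ((spow a (n + 1) : S) : WithOne S) = (a : WithOne S) ^ (n + 1) := by
  induction n with
  | zero => simp [spow]
  | succ n ih => rw [spow, WithOne.coe_mul, ih, ← pow_succ]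

/-! ### Varieties and their models -/

namespace ComVariety

theorem mem_theory {V : ComVariety} {i : SGId} :
    i ∈ V.theory ↔ ∀ S ∈ modelsOf V.theory, SGSatisfies S.carrier i := by
  conv_lhs => rw [← V.closed]
  rfl

theorem mem_models_of_le {V W : ComVariety} (h : V ≤ W) {S : ComSG}
    (hS : S ∈ modelsOf V.theory) : S ∈ modelsOf W.theory := modelsOf_antitone h hS

end ComVariety

theorem mem_models_comVar {E : Set SGId} {S : ComSG} :
    S ∈ modelsOf (comVar E).theory ↔ S ∈ modelsOf E :=
  ⟨fun h => modelsOf_antitone (subset_theoryOfClass_modelsOf E) h, fun h _ hi => hi S h⟩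

theorem mem_comVar {E : Set SGId} {i : SGId} :
    i ∈ (comVar E).theory ↔ ∀ S ∈ modelsOf E, SGSatisfies S.carrier i := Iff.rfl

theorem comVar_le {E : Set SGId} {V : ComVariety} (h : V.theory ⊆ E) : comVar E ≤ V :=
  h.trans (subset_theoryOfClass_modelsOf E)

theorem le_comVar {E : Set SGId} {V : ComVariety} (h : E ⊆ V.theory) : V ≤ comVar E := by
  intro i hi
  rw [ComVariety.mem_theory]
  intro S hS
  exact hi S (modelsOf_antitone h hS)

/-- The element `W` is below every element. -/
def IsBottom {L : Type*} [LE L] (W : L) : Prop := ∀ U, W ≤ U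

/-- Every element below `Y` is a bottom element or lies above `Z`. -/
def HasBase {L : Type*} [LE L] (Z Y : L) : Prop := ∀ W, W ≤ Y → IsBottom W ∨ Z ≤ W

theorem isBottom_iff {W : ComVariety} :
    IsBottom W ↔ ∀ S ∈ modelsOf W.theory, ∀ a b : S.carrier, a = b := by
  constructor
  · intro h S hS a b
    have h1 : (ltr 0, ltr 1) ∈ W.theory :=
      h Tvar (subset_theoryOfClass_modelsOf _ (Set.mem_singleton _))
    simpa [ltr] using hS _ h1 (fun n => if n = 0 then a else b)
  · intro h U i _
    rw [ComVariety.mem_theory]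
    intro S hS f
    exact h S hS _ _

/-! ### Varieties without nontrivial null semigroups -/

theorem mem_ZMvar_of_length {u v : SGWord} (hu : 2 ≤ (letters u).length)
    (hv : 2 ≤ (letters v).length) : (u, v) ∈ ZMvar.theory := by
  refine mem_comVar.2 fun S hS => ?_
  have key : ∀ a b z : S.carrier, a * b * z = a * b := by
    intro a b z
    have := hS (ltr 0 * ltr 1 * ltr 2, ltr 0 * ltr 1) (by simp [zeroId])
      (fun n => if n = 0 then a else if n = 1 then b else z)
    simpa [ltr] using this
  have key2 : ∀ a b c d : S.carrier, a * b = c * d := by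
    intro a b c d
    rw [← key a b (c * d), mul_comm (a * b), key]
  have dec : ∀ w : SGWord, 2 ≤ (letters w).length → ∀ f : ℕ → S.carrier,
      ∃ a b, FreeSemigroup.lift f w = a * b := by
    intro w hw f
    induction w using FreeSemigroup.recOnMul with
    | ih1 x => exact absurd hw (by simp [letters])
    | ih2 x y _ _ => exact ⟨_, _, map_mul _ _ _⟩
  intro f
  obtain ⟨a, b, h1⟩ := dec u hu f
  obtain ⟨c, d, h2⟩ := dec v hv f
  simp only [h1, h2]
  exact key2 _ _ _ _

theorem exists_pow_mul_self_of_satisfies {x : ℕ} {v : SGWord} (hv : v ≠ ltr x) :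
    ∃ k, k ≠ 0 ∧ ∀ (S : Type) [CommSemigroup S], SGSatisfies S (ltr x, v) →
      ∀ a : S, (a : WithOne S) ^ k * a = a := by
  by_cases h1 : v.tail = []
  · refine ⟨1, one_ne_zero, fun S _ hS a => ?_⟩
    have hne : v.head ≠ x := by
      intro h
      exact hv (FreeSemigroup.ext h h1)
    have := hS.prod_eq (fun n => if n = x then a * a else a)
    simpa [letters, h1, ltr, hne] using this
  · refine ⟨v.tail.length, by simpa using h1, fun S _ hS a => ?_⟩
    have := hS.prod_eq (fun _ => a)
    simpa [letters, ltr, ← pow_succ', ← pow_succ] using this.symm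

theorem exists_pow_mul_self {V : ComVariety} (h : ¬ ZMvar ≤ V) :
    ∃ k, k ≠ 0 ∧ ∀ S ∈ modelsOf V.theory, ∀ a : S.carrier,
      (a : WithOne S.carrier) ^ k * a = a := by
  obtain ⟨⟨u, v⟩, hV, hZ⟩ := Set.not_subset.1 h
  have single : ∀ w : SGWord, ¬ 2 ≤ (letters w).length → w = ltr w.head := by
    intro w hw
    refine FreeSemigroup.ext rfl ?_
    have : w.tail.length = 0 := by
      simp [letters] at hw
      simp [hw]
    simpa [ltr] using this
  have hne : u ≠ v := by
    rintro rfl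
    exact hZ fun S _ _ => rfl
  by_cases hu : 2 ≤ (letters u).length
  · by_cases hv : 2 ≤ (letters v).length
    · exact absurd (mem_ZMvar_of_length hu hv) hZ
    · obtain ⟨k, hk, h⟩ := exists_pow_mul_self_of_satisfies (x := v.head) (v := u)
        (by rwa [← single v hv])
      exact ⟨k, hk, fun S hS => h _ (by rw [← single v hv]; exact (hS _ hV).symm)⟩
  · obtain ⟨k, hk, h⟩ := exists_pow_mul_self_of_satisfies (x := u.head) (v := v)
      (by rw [← single u hu]; exact hne.symm)
    exact ⟨k, hk, fun S hS => h _ (by rw [← single u hu]; exact hS _ hV)⟩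

/-! ### Varieties without nontrivial semilattices -/

/-- The two-element semilattice. -/
def meetSG : ComSG :=
  { carrier := Bool
    str := { mul := (· && ·), mul_assoc := Bool.and_assoc, mul_comm := Bool.and_comm } }

/-- The two-element null semigroup. -/
def nullSG : ComSG :=
  { carrier := Bool
    str := { mul := fun _ _ => false, mul_assoc := fun _ _ _ => rfl, mul_comm := fun _ _ => rfl } }

theorem meetSG_mem : meetSG ∈ modelsOf SLvar.theory := by
  refine mem_models_comVar.2 ?_
  rintro i (rfl | rfl)
  · intro f
    simp only [wpow, map_mul]
    exact Bool.and_self _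
  · exact satisfies_commId _

theorem nullSG_mem : nullSG ∈ modelsOf ZMvar.theory := by
  refine mem_models_comVar.2 ?_
  rintro i (rfl | rfl | rfl)
  · exact satisfies_commId _
  · intro f
    simp only [map_mul]
    rfl
  · intro f
    simp only [map_mul]
    rfl

theorem mul_self_of_mem_SLvar {S : ComSG} (hS : S ∈ modelsOf SLvar.theory) (a : S.carrier) :
    a * a = a := by
  simpa [wpow, ltr] using mem_models_comVar.1 hS (wpow (ltr 0) 2, ltr 0) (by simp) (fun _ => a)

theorem mul_eq_of_idempotent {S : Type} [CommSemigroup S] {u v : SGWord}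
    (h : SGSatisfies S (u, v)) {c : ℕ} (hu : c ∈ letters u) (hv : c ∉ letters v) {e f : S}
    (he : e * e = e) (hf : f * f = f) : e * f = f := by
  have h1 := h.prod_eq (fun n => if n = c then e else f)
  simp only [apply_ite (fun x : S => (x : WithOne S))] at h1
  rw [prod_map_ite, prod_map_ite, List.count_eq_zero.2 hv] at h1
  have he' : (e : WithOne S) * e = e := by rw [← WithOne.coe_mul, he]
  have hf' : (f : WithOne S) * f = f := by rw [← WithOne.coe_mul, hf]
  have hfp : ∀ n, (f : WithOne S) ^ n * f = f := by
    intro n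
    rw [← pow_succ, pow_eq_self_of_mul_self hf' n.succ_ne_zero]
  rw [pow_eq_self_of_mul_self he' (List.count_pos_iff.2 hu).ne'] at h1
  have h2 := congrArg (· * (f : WithOne S)) h1
  simp only [mul_assoc, hfp, pow_zero, one_mul] at h2
  exact WithOne.coe_injective (by rw [WithOne.coe_mul, h2])

theorem not_mem_SLvar {u v : SGWord} {c : ℕ} (hu : c ∈ letters u) (hv : c ∉ letters v) :
    (u, v) ∉ SLvar.theory := by
  intro h
  have := mul_eq_of_idempotent (meetSG_mem _ h) hu hv (e := false) (f := true) rfl rfl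
  exact Bool.false_ne_true this

theorem mem_SLvar {u v : SGWord} (h : (letters u).toFinset = (letters v).toFinset) :
    (u, v) ∈ SLvar.theory := by
  rw [ComVariety.mem_theory]
  intro S hS
  refine satisfies_of_prod_eq fun f => ?_
  have key : ∀ w : SGWord, ((letters w).map fun c => (f c : WithOne S.carrier)).prod =
      ∏ c ∈ (letters w).toFinset, (f c : WithOne S.carrier) := by
    intro w
    rw [Finset.prod_list_map_count]
    refine Finset.prod_congr rfl fun c hc => pow_eq_self_of_mul_self ?_ ?_
    · rw [← WithOne.coe_mul, mul_self_of_mem_SLvar hS]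
    · exact (List.count_pos_iff.2 (List.mem_toFinset.1 hc)).ne'
  rw [key, key, h]

theorem idempotent_unique {V : ComVariety} (h : ¬ SLvar ≤ V) {S : ComSG}
    (hS : S ∈ modelsOf V.theory) {e f : S.carrier} (he : e * e = e) (hf : f * f = f) :
    e = f := by
  obtain ⟨⟨u, v⟩, hV, hSL⟩ := Set.not_subset.1 h
  have key : ∀ {e f : S.carrier}, e * e = e → f * f = f → e * f = f := by
    intro e f he hf
    by_contra hc
    refine hSL (mem_SLvar ?_)
    ext c
    simp only [List.mem_toFinset]
    constructor
    · intro h1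
      by_contra h2
      exact hc (mul_eq_of_idempotent (hS _ hV) h1 h2 he hf)
    · intro h1
      by_contra h2
      exact hc (mul_eq_of_idempotent (hS _ hV).symm h1 h2 he hf)
  rw [← key hf he, mul_comm, key he hf]

/-! ### Periodic group varieties -/

/-- The law `a ^ d * b = b` holds in all members of `V`. -/
def HasExponent (V : ComVariety) (d : ℕ) : Prop :=
  ∀ S ∈ modelsOf V.theory, ∀ a b : S.carrier, (a : WithOne S.carrier) ^ d * b = b

theorem exists_hasExponent {V : ComVariety} (hSL : ¬ SLvar ≤ V) (hZM : ¬ ZMvar ≤ V) :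
    ∃ d, d ≠ 0 ∧ HasExponent V d := by
  obtain ⟨k, hk, h⟩ := exists_pow_mul_self hZM
  refine ⟨k, hk, fun S hS a b => ?_⟩
  obtain ⟨e, he⟩ := exists_coe_eq_pow a hk
  obtain ⟨f, hf⟩ := exists_coe_eq_pow b hk
  have idem : ∀ x y : S.carrier, (y : WithOne S.carrier) = (x : WithOne S.carrier) ^ k →
      y * y = y := by
    intro x y hy
    apply WithOne.coe_injective
    obtain ⟨m, rfl⟩ := Nat.exists_eq_succ_of_ne_zero hk
    rw [WithOne.coe_mul, hy]
    nth_rw 2 [pow_succ']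
    rw [← mul_assoc, h S hS, pow_succ']
  rw [← he, idempotent_unique hSL hS (idem a e he) (idem b f hf), hf, h S hS]

theorem HasExponent.of_dvd {V : ComVariety} {n d : ℕ} (h : HasExponent V n) (hd : n ∣ d) :
    HasExponent V d := by
  obtain ⟨m, rfl⟩ := hd
  intro S hS a b
  induction m with
  | zero => simp
  | succ m ih => rw [Nat.mul_succ, pow_add, mul_assoc, h S hS, ih]

theorem pow_mul_eq_of_modEq {V : ComVariety} {n i j : ℕ} (h : HasExponent V n)
    (hij : i ≡ j [MOD n]) {S : ComSG} (hS : S ∈ modelsOf V.theory) (a b : S.carrier) :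
    (a : WithOne S.carrier) ^ i * b = (a : WithOne S.carrier) ^ j * b := by
  wlog hle : i ≤ j generalizing i j
  · exact (this hij.symm (le_of_not_ge hle)).symm
  obtain ⟨d, rfl⟩ := Nat.exists_eq_add_of_le hle
  have hd : n ∣ d := by simpa using (Nat.modEq_iff_dvd' hle).1 hij
  rw [pow_add, mul_assoc, h.of_dvd hd S hS]

theorem prod_mul_eq_of_modEq {V : ComVariety} {n : ℕ} (h : HasExponent V n) {S : ComSG}
    (hS : S ∈ modelsOf V.theory) (s : Finset ℕ) (f : ℕ → S.carrier) (i j : ℕ → ℕ)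
    (hij : ∀ c, i c ≡ j c [MOD n]) (b : S.carrier) :
    (∏ c ∈ s, (f c : WithOne S.carrier) ^ i c) * b =
      (∏ c ∈ s, (f c : WithOne S.carrier) ^ j c) * b := by
  induction s using Finset.induction_on generalizing b with
  | empty => simp
  | insert c s hc ih =>
    obtain ⟨b', hb'⟩ : ∃ b' : S.carrier, (b' : WithOne S.carrier) =
        (f c : WithOne S.carrier) ^ j c * b := by
      by_cases h0 : j c = 0
      · exact ⟨b, by simp [h0]⟩
      · obtain ⟨x, hx⟩ := exists_coe_eq_pow (f c) h0
        exact ⟨x * b, by rw [WithOne.coe_mul, hx]⟩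
    rw [Finset.prod_insert hc, Finset.prod_insert hc, mul_right_comm,
      pow_mul_eq_of_modEq h (hij c) hS, ← hb', mul_comm (b' : WithOne S.carrier), ih,
      mul_comm _ (b' : WithOne S.carrier), hb', mul_right_comm]

/-- The identities whose sides contain each letter equally often modulo `n`. -/
def congrTheory (n : ℕ) : Set SGId :=
  {i | ∀ c, (letters i.1).count c ≡ (letters i.2).count c [MOD n]}

theorem congrTheory_subset {V : ComVariety} {n : ℕ} (hn : n ≠ 0) (h : HasExponent V n) :
    congrTheory n ⊆ V.theory := by
  rintro ⟨u, v⟩ hi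
  rw [ComVariety.mem_theory]
  intro S hS f
  obtain ⟨e, he⟩ := exists_coe_eq_pow (f 0) hn
  have unit : ∀ x : S.carrier, x * e = x := by
    intro x
    apply WithOne.coe_injective
    rw [WithOne.coe_mul, he, mul_comm, h S hS]
  have key : ∀ w : SGWord, (letters w).toFinset ⊆ (letters u ++ letters v).toFinset →
      ((FreeSemigroup.lift f w : S.carrier) : WithOne S.carrier) =
      (∏ c ∈ (letters u ++ letters v).toFinset,
        (f c : WithOne S.carrier) ^ (letters w).count c) * e := by
    intro w hw
    rw [← unit (FreeSemigroup.lift f w), WithOne.coe_mul, coe_lift,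
      Finset.prod_list_map_count]
    congr 1
    refine Finset.prod_subset hw fun c _ hc => ?_
    rw [List.count_eq_zero.2 (by simpa using hc), pow_zero]
  apply WithOne.coe_injective
  change ((FreeSemigroup.lift f u : S.carrier) : WithOne S.carrier) =
    (FreeSemigroup.lift f v : S.carrier)
  rw [key u (by simp), key v (by simp)]
  exact prod_mul_eq_of_modEq h hS _ _ _ _ hi e

theorem subset_congrTheory {V : ComVariety} {n : ℕ} (hn : n ≠ 0) (h : HasExponent V n)
    (hmin : ∀ d, HasExponent V d → n ∣ d) : V.theory ⊆ congrTheory n := by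
  rintro ⟨u, v⟩ hV c
  have key : ∀ i j : ℕ, i ≤ j → (∀ S ∈ modelsOf V.theory, ∀ a b : S.carrier,
      (a : WithOne S.carrier) ^ i * b = (a : WithOne S.carrier) ^ j * b) → i ≡ j [MOD n] := by
    intro i j hle hij
    obtain ⟨d, rfl⟩ := Nat.exists_eq_add_of_le hle
    refine (Nat.modEq_iff_dvd' hle).2 (hmin _ fun S hS a b => ?_)
    rw [Nat.add_sub_cancel_left]
    obtain ⟨m, rfl⟩ := Nat.exists_eq_succ_of_ne_zero hn
    have h1 := congrArg ((a : WithOne S.carrier) ^ (m * i) * ·) (hij S hS a b)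
    simp only [← mul_assoc, ← pow_add] at h1
    have e1 : m * i + i = (m + 1) * i := by ring
    rw [← add_assoc, e1, h.of_dvd (Dvd.intro _ rfl) S hS,
      pow_mul_eq_of_modEq h (j := d) _ hS] at h1
    · exact h1.symm
    · simp [Nat.ModEq]
  have law : ∀ S ∈ modelsOf V.theory, ∀ a b : S.carrier,
      (a : WithOne S.carrier) ^ (letters u).count c * b =
        (a : WithOne S.carrier) ^ (letters v).count c * b := by
    intro S hS a b
    obtain ⟨e, he⟩ := exists_coe_eq_pow a hn
    have h1 := (hS _ hV).prod_eq (fun x => if x = c then a else e)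
    simp only [apply_ite (fun x : S.carrier => (x : WithOne S.carrier))] at h1
    rw [prod_map_ite, prod_map_ite, he, ← pow_mul, ← pow_mul] at h1
    have h2 := congrArg (· * (b : WithOne S.carrier)) h1
    simpa only [mul_assoc, h.of_dvd (Dvd.intro _ rfl) S hS] using h2
  rcases le_total ((letters u).count c) ((letters v).count c) with hle | hle
  · exact key _ _ hle law
  · exact (key _ _ hle fun S hS a b => (law S hS a b).symm).symm

theorem exists_theory_eq_congrTheory {V : ComVariety} (hSL : ¬ SLvar ≤ V)
    (hZM : ¬ ZMvar ≤ V) : ∃ n, n ≠ 0 ∧ V.theory = congrTheory n := by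
  classical
  have hex := exists_hasExponent hSL hZM
  obtain ⟨hn, hexp⟩ := Nat.find_spec hex
  refine ⟨Nat.find hex, hn, subset_antisymm (subset_congrTheory hn hexp fun d hd => ?_)
    (congrTheory_subset hn hexp)⟩
  by_contra hdvd
  have hlt := Nat.mod_lt d (Nat.pos_of_ne_zero hn)
  refine Nat.find_min hex hlt ⟨fun h0 => hdvd (Nat.dvd_of_mod_eq_zero h0), fun S hS a b => ?_⟩
  rw [pow_mul_eq_of_modEq hexp (Nat.mod_modEq d _) hS, hd S hS]

/-- The variety of Abelian groups of exponent dividing `n`, through its identities. -/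
def congrVar (n : ℕ) : ComVariety where
  theory := congrTheory n
  closed := by
    refine subset_antisymm ?_ (subset_theoryOfClass_modelsOf _)
    have hpow : ∀ (f : ℕ → Multiplicative (ZMod n)) (s : Finset ℕ) (w : SGWord),
        (letters w).toFinset ⊆ s →
        ((letters w).map f).prod = ∏ c ∈ s, f c ^ (letters w).count c := by
      intro f s w hw
      rw [Finset.prod_list_map_count]
      refine Finset.prod_subset hw fun c _ hc => ?_
      rw [List.count_eq_zero.2 (by simpa using hc), pow_zero]
    have hmem : (⟨Multiplicative (ZMod n)⟩ : ComSG) ∈ modelsOf (congrTheory n) := by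
      rintro ⟨u, v⟩ hi
      refine satisfies_iff_prod_eq.2 fun f => ?_
      rw [hpow f (letters u ++ letters v).toFinset u (by simp),
        hpow f (letters u ++ letters v).toFinset v (by simp)]
      refine Finset.prod_congr rfl fun c _ => ?_
      apply Multiplicative.toAdd.injective
      have := (ZMod.natCast_eq_natCast_iff _ _ _).2 (hi c)
      simp only [toAdd_pow, nsmul_eq_mul, this]
    rintro ⟨u, v⟩ hi c
    have h1 := (satisfies_iff_prod_eq (S := Multiplicative (ZMod n))).1 (hi _ hmem)
      (fun x => if x = c then Multiplicative.ofAdd (1 : ZMod n) else 1)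
    rw [prod_map_ite, prod_map_ite, one_pow, one_pow, mul_one, mul_one] at h1
    have h2 := congrArg Multiplicative.toAdd h1
    simpa [ZMod.natCast_eq_natCast_iff] using h2

theorem exists_eq_congrVar {V : ComVariety} (hSL : ¬ SLvar ≤ V) (hZM : ¬ ZMvar ≤ V) :
    ∃ n, n ≠ 0 ∧ V = congrVar n := by
  obtain ⟨n, hn, h⟩ := exists_theory_eq_congrTheory hSL hZM
  exact ⟨n, hn, ComVariety.ext' h⟩

theorem wpow_mul_mem_congrTheory (m n : ℕ) :
    (wpow (ltr 0) (n + 1) * ltr 1, ltr 1) ∈ congrTheory m ↔ m ∣ n + 1 := by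
  simp only [congrTheory, Set.mem_ofPred_eq, letters_mul, letters_wpow_succ, letters_ltr,
    List.count_append, List.count_replicate]
  constructor
  · intro h
    simpa [Nat.modEq_zero_iff_dvd] using h 0
  · intro h c
    by_cases hc : c = 0
    · subst hc
      simpa [Nat.modEq_zero_iff_dvd] using h
    · simp [Ne.symm hc, Nat.ModEq.refl]

theorem satisfies_wpow_mul_iff {S : Type} [Semigroup S] {n : ℕ} :
    SGSatisfies S (wpow (ltr 0) (n + 1) * ltr 1, ltr 1) ↔
      ∀ a b : S, (a : WithOne S) ^ (n + 1) * b = b := by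
  constructor
  · intro h a b
    have := h.prod_eq (fun x => if x = 0 then a else b)
    simpa [letters_mul, letters_wpow_succ, letters_ltr] using this
  · intro h
    refine satisfies_of_prod_eq fun f => ?_
    simpa [letters_mul, letters_wpow_succ, letters_ltr] using h (f 0) (f 1)

theorem congrVar_le_iff {m n : ℕ} (hn : n ≠ 0) : congrVar m ≤ congrVar n ↔ m ∣ n := by
  constructor
  · intro h
    obtain ⟨k, rfl⟩ := Nat.exists_eq_succ_of_ne_zero hn
    exact (wpow_mul_mem_congrTheory m k).1 (h ((wpow_mul_mem_congrTheory _ k).2 dvd_rfl))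
  · intro h i hi c
    exact (hi c).of_dvd h

theorem isBottom_congrVar_one : IsBottom (congrVar 1) := fun _ _ _ _ => Nat.modEq_one

theorem hasExponent_congrVar {n : ℕ} (hn : n ≠ 0) : HasExponent (congrVar n) n := by
  obtain ⟨k, rfl⟩ := Nat.exists_eq_succ_of_ne_zero hn
  intro S hS
  exact satisfies_wpow_mul_iff.1 (hS _ ((wpow_mul_mem_congrTheory _ k).2 dvd_rfl))

theorem isGroupVariety_congrVar {n : ℕ} (hn : n ≠ 0) : IsGroupVariety (congrVar n) := by
  intro S hS
  have h := hasExponent_congrVar hn S hS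
  obtain ⟨a₀⟩ := S.instNonempty
  obtain ⟨e, he⟩ := exists_coe_eq_pow a₀ hn
  have unit : ∀ a, e * a = a := by
    intro a
    apply WithOne.coe_injective
    rw [WithOne.coe_mul, he, h]
  refine ⟨e, fun a => ⟨unit a, by rw [mul_comm, unit]⟩, fun a => ?_⟩
  obtain ⟨b, hb⟩ := exists_coe_eq_pow a (n := 2 * n - 1) (by omega)
  have hab : a * b = e := by
    apply WithOne.coe_injective
    obtain ⟨f, hf⟩ := exists_coe_eq_pow a hn
    have hef : (f : WithOne S.carrier) * e = f := by
      rw [← WithOne.coe_mul, mul_comm, unit]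
    rw [WithOne.coe_mul, hb, ← pow_succ', show 2 * n - 1 + 1 = n + n by omega, pow_add, ← hf]
    nth_rw 1 [hf]
    rw [h, ← hef, hf, h]
  exact ⟨b, hab, by rw [mul_comm, hab]⟩

theorem isPeriodicVariety_congrVar {n : ℕ} (hn : n ≠ 0) : IsPeriodicVariety (congrVar n) := by
  intro S hS a
  refine ⟨1, n + 1, le_rfl, by omega, ?_⟩
  apply WithOne.coe_injective
  rw [coe_spow_succ a 0, coe_spow_succ, pow_succ _ n, hasExponent_congrVar hn S hS]
  simp

theorem not_isGroupSG_meetSG : ¬ IsGroupSG meetSG.carrier := by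
  rintro ⟨e, h1, h2⟩
  have he : e = true := by
    have : ∀ x : Bool, (x && true) = true → x = true := by decide
    exact this e (h1 true).1
  obtain ⟨b, hb, -⟩ := h2 false
  rw [he] at hb
  exact Bool.false_ne_true hb

theorem not_isGroupSG_nullSG : ¬ IsGroupSG nullSG.carrier := by
  rintro ⟨e, h1, -⟩
  exact Bool.false_ne_true (h1 true).1

theorem isGroupVariety_and_isPeriodicVariety_iff (V : ComVariety) :
    (IsGroupVariety V ∧ IsPeriodicVariety V) ↔ (¬ SLvar ≤ V ∧ ¬ ZMvar ≤ V) := by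
  constructor
  · rintro ⟨h, -⟩
    exact ⟨fun hle => not_isGroupSG_meetSG (h _ (ComVariety.mem_models_of_le hle meetSG_mem)),
      fun hle => not_isGroupSG_nullSG (h _ (ComVariety.mem_models_of_le hle nullSG_mem))⟩
  · rintro ⟨h1, h2⟩
    obtain ⟨n, hn, rfl⟩ := exists_eq_congrVar h1 h2
    exact ⟨isGroupVariety_congrVar hn, isPeriodicVariety_congrVar hn⟩

/-! ### An order-theoretic description of the periodic group varieties -/

/-- Every atom `Z` below `V` lies strictly below an element with base `Z`, and the elements
with base `Z` form a chain. -/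
def HasGroupAtoms {L : Type*} [LE L] (V : L) : Prop :=
  ∀ Z, Z ≤ V → ¬ IsBottom Z → HasBase Z Z →
    (∃ Y, HasBase Z Y ∧ ¬ Y ≤ Z) ∧
      ∀ Y₁, HasBase Z Y₁ → ∀ Y₂, HasBase Z Y₂ → Y₁ ≤ Y₂ ∨ Y₂ ≤ Y₁

theorem not_SLvar_le_congrVar {n : ℕ} (hn : n ≠ 0) : ¬ SLvar ≤ congrVar n :=
  ((isGroupVariety_and_isPeriodicVariety_iff _).1
    ⟨isGroupVariety_congrVar hn, isPeriodicVariety_congrVar hn⟩).1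

theorem not_ZMvar_le_congrVar {n : ℕ} (hn : n ≠ 0) : ¬ ZMvar ≤ congrVar n :=
  ((isGroupVariety_and_isPeriodicVariety_iff _).1
    ⟨isGroupVariety_congrVar hn, isPeriodicVariety_congrVar hn⟩).2

theorem exists_eq_congrVar_of_le {n : ℕ} (hn : n ≠ 0) {W : ComVariety} (h : W ≤ congrVar n) :
    ∃ m, m ≠ 0 ∧ m ∣ n ∧ W = congrVar m := by
  obtain ⟨m, hm, rfl⟩ := exists_eq_congrVar
    (fun h1 => not_SLvar_le_congrVar hn (h1.trans h))
    (fun h1 => not_ZMvar_le_congrVar hn (h1.trans h))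
  exact ⟨m, hm, (congrVar_le_iff hn).1 h, rfl⟩

theorem isBottom_congrVar_iff {n : ℕ} : IsBottom (congrVar n) ↔ n = 1 := by
  constructor
  · intro h
    exact Nat.dvd_one.1 ((congrVar_le_iff one_ne_zero).1 (h (congrVar 1)))
  · rintro rfl
    exact isBottom_congrVar_one

theorem hasBase_congrVar_iff {q n : ℕ} (hn : n ≠ 0) :
    HasBase (congrVar q) (congrVar n) ↔ ∀ d, d ∣ n → d = 1 ∨ q ∣ d := by
  constructor
  · intro h d hd
    have hd0 : d ≠ 0 := ne_zero_of_dvd_ne_zero hn hd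
    simpa only [isBottom_congrVar_iff, congrVar_le_iff hd0] using
      h (congrVar d) ((congrVar_le_iff hn).2 hd)
  · intro h W hW
    obtain ⟨m, hm, hmn, rfl⟩ := exists_eq_congrVar_of_le hn hW
    simpa only [isBottom_congrVar_iff, congrVar_le_iff hm] using h m hmn

theorem not_isBottom_SLvar : ¬ IsBottom SLvar := fun h =>
  Bool.false_ne_true (isBottom_iff.1 h meetSG meetSG_mem false true)

theorem not_isBottom_ZMvar : ¬ IsBottom ZMvar := fun h =>
  Bool.false_ne_true (isBottom_iff.1 h nullSG nullSG_mem false true)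

theorem not_congrVar_le_SLvar {q : ℕ} (hq : q ≠ 1) : ¬ congrVar q ≤ SLvar := by
  intro h
  have h1 := h (mem_SLvar (u := ltr 0 * ltr 0) (v := ltr 0) (by simp [letters_mul, letters_ltr])) 0
  have h2 : 1 ≡ 2 [MOD q] := by simpa [letters_mul, letters_ltr] using h1.symm
  exact hq (Nat.dvd_one.1 ((Nat.modEq_iff_dvd' (by norm_num)).1 h2))

theorem not_congrVar_le_ZMvar {q : ℕ} (hq : q ≠ 1) : ¬ congrVar q ≤ ZMvar := by
  intro h
  have h1 := h (mem_ZMvar_of_length (u := ltr 0 * ltr 0 * ltr 0) (v := ltr 0 * ltr 0)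
    (by simp [letters_mul, letters_ltr]) (by simp [letters_mul, letters_ltr])) 0
  have h2 : 2 ≡ 3 [MOD q] := by simpa [letters_mul, letters_ltr] using h1.symm
  exact hq (Nat.dvd_one.1 ((Nat.modEq_iff_dvd' (by norm_num)).1 h2))

theorem exists_eq_congrVar_of_hasBase {q : ℕ} (hq : q ≠ 1) {Y : ComVariety}
    (h : HasBase (congrVar q) Y) : ∃ n, n ≠ 0 ∧ Y = congrVar n :=
  exists_eq_congrVar
    (fun hle => (h _ hle).elim not_isBottom_SLvar (not_congrVar_le_SLvar hq))
    (fun hle => (h _ hle).elim not_isBottom_ZMvar (not_congrVar_le_ZMvar hq))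

theorem hasGroupAtoms_congrVar {n : ℕ} (hn : n ≠ 0) : HasGroupAtoms (congrVar n) := by
  intro Z hZ hbot hbase
  obtain ⟨q, hq, -, rfl⟩ := exists_eq_congrVar_of_le hn hZ
  rw [isBottom_congrVar_iff] at hbot
  rw [hasBase_congrVar_iff hq] at hbase
  have hprime : q.Prime := by
    have hmp := Nat.minFac_prime hbot
    rcases hbase _ (Nat.minFac_dvd q) with h | h
    · exact absurd h hmp.ne_one
    · rwa [Nat.dvd_antisymm h (Nat.minFac_dvd q)]
  have hpow : ∀ Y, HasBase (congrVar q) Y → ∃ k, Y = congrVar (q ^ k) := by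
    intro Y hY
    obtain ⟨m, hm, rfl⟩ := exists_eq_congrVar_of_hasBase hbot hY
    rw [hasBase_congrVar_iff hm] at hY
    refine ⟨_, congrArg congrVar (Nat.eq_prime_pow_of_unique_prime_dvd hm fun {d} hd hdm => ?_)⟩
    rcases hY d hdm with h | h
    · exact absurd h hd.ne_one
    · exact ((Nat.prime_dvd_prime_iff_eq hprime hd).1 h).symm
  refine ⟨⟨congrVar (q ^ 2), ?_, ?_⟩, fun Y₁ h₁ Y₂ h₂ => ?_⟩
  · rw [hasBase_congrVar_iff (pow_ne_zero _ hq)]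
    intro d hd
    obtain ⟨k, -, rfl⟩ := (Nat.dvd_prime_pow hprime).1 hd
    rcases Nat.eq_zero_or_pos k with rfl | hk
    · exact Or.inl (pow_zero q)
    · exact Or.inr (dvd_pow_self q hk.ne')
  · rw [congrVar_le_iff hq]
    intro h
    have := Nat.le_of_dvd hprime.pos h
    nlinarith [hprime.two_le]
  · obtain ⟨k, rfl⟩ := hpow Y₁ h₁
    obtain ⟨l, rfl⟩ := hpow Y₂ h₂
    rw [congrVar_le_iff (pow_ne_zero _ hq), congrVar_le_iff (pow_ne_zero _ hq)]
    exact (le_total k l).imp (pow_dvd_pow q) (pow_dvd_pow q)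

theorem hasBase_SLvar_SLvar : HasBase SLvar SLvar := by
  intro W hW
  by_contra! h
  refine h.1 (isBottom_iff.2 fun S hS a b => ?_)
  have hS' := ComVariety.mem_models_of_le hW hS
  exact idempotent_unique h.2 hS (mul_self_of_mem_SLvar hS' a) (mul_self_of_mem_SLvar hS' b)

theorem not_SLvar_le_of_mem {V : ComVariety} {u v : SGWord} (h : (u, v) ∈ V.theory) {c : ℕ}
    (hu : c ∈ letters u) (hv : c ∉ letters v) : ¬ SLvar ≤ V := fun hle =>
  not_mem_SLvar hu hv (hle h)

theorem not_SLvar_le_ZMvar : ¬ SLvar ≤ ZMvar :=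
  not_SLvar_le_of_mem (u := ltr 0 * ltr 1) (v := ltr 0 * ltr 0) (c := 1)
    (mem_ZMvar_of_length (by simp [letters_mul, letters_ltr]) (by simp [letters_mul, letters_ltr]))
    (by simp [letters_mul, letters_ltr]) (by simp [letters_mul, letters_ltr])

theorem le_SLvar_of_hasBase {Y : ComVariety} (h : HasBase SLvar Y) : Y ≤ SLvar := by
  have hZM : ¬ ZMvar ≤ Y := fun hle =>
    (h _ hle).elim not_isBottom_ZMvar not_SLvar_le_ZMvar
  obtain ⟨k, hk, hpow⟩ := exists_pow_mul_self hZM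
  obtain ⟨k, rfl⟩ := Nat.exists_eq_succ_of_ne_zero hk
  let E : Set SGId := insert (wpow (ltr 0) (k + 1) * ltr 1, ltr 1) Y.theory
  have hbot : IsBottom (comVar E) := by
    refine (h _ (comVar_le (Set.subset_insert _ _))).resolve_right ?_
    refine not_SLvar_le_of_mem (subset_theoryOfClass_modelsOf E (Set.mem_insert _ _)) (c := 0)
      ?_ ?_
    · simp [letters_mul, letters_wpow_succ]
    · simp [letters_ltr]
  rw [isBottom_iff] at hbot
  have idem : ∀ S ∈ modelsOf Y.theory, ∀ a : S.carrier, a * a = a := by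
    intro S hS a
    have hsq : ∀ x : S.carrier, (x : WithOne S.carrier) ^ (k + 1) * x ^ (k + 1) =
        (x : WithOne S.carrier) ^ (k + 1) := by
      intro x
      nth_rw 2 [pow_succ']
      rw [← mul_assoc, hpow S hS, ← pow_succ']
    let T : Subsemigroup S.carrier :=
      { carrier := {x | (x : WithOne S.carrier) ^ (k + 1) = (a : WithOne S.carrier) ^ (k + 1)}
        mul_mem' := by
          intro x y hx hy
          simp only [Set.mem_ofPred_eq] at hx hy ⊢
          rw [WithOne.coe_mul, mul_pow, hx, hy, hsq] }
    have haT : a ∈ T := rfl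
    have : Nonempty T := ⟨⟨a, haT⟩⟩
    have hT : (⟨T⟩ : ComSG) ∈ modelsOf E := by
      rintro i (rfl | hi)
      · intro f
        apply Subtype.val_injective
        have hf0 : ((f 0 : S.carrier) : WithOne S.carrier) ^ (k + 1) =
            (a : WithOne S.carrier) ^ (k + 1) := (f 0).2
        have hf1 : ((f 1 : S.carrier) : WithOne S.carrier) ^ (k + 1) =
            (a : WithOne S.carrier) ^ (k + 1) := (f 1).2
        have hl := map_lift (MulMemClass.subtype T) f (wpow (ltr 0) (k + 1) * ltr 1)
        have hr := map_lift (MulMemClass.subtype T) f (ltr 1)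
        refine hl.trans (Eq.trans ?_ hr.symm)
        apply WithOne.coe_injective
        rw [coe_lift, coe_lift]
        simp only [letters_mul, letters_wpow_succ, letters_ltr, List.map_append,
          List.map_replicate, List.prod_append, List.prod_replicate, List.map_cons, List.map_nil,
          List.prod_cons, List.prod_nil, mul_one]
        change ((f 0 : S.carrier) : WithOne S.carrier) ^ (k + 1) * (f 1 : S.carrier) =
          (f 1 : S.carrier)
        rw [hf0, ← hf1, hpow S hS]
      · exact (hS i hi).of_injective (MulMemClass.subtype T) Subtype.val_injective
    have := hbot ⟨T⟩ (mem_models_comVar.2 hT) ⟨a * a, T.mul_mem haT haT⟩ ⟨a, haT⟩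
    exact congrArg Subtype.val this
  refine le_comVar ?_
  rintro i (rfl | rfl) <;> rw [ComVariety.mem_theory] <;> intro S hS
  · intro f
    simpa [wpow] using idem S hS _
  · exact satisfies_commId _

theorem hasBase_ZMvar_of_cube {Y : ComVariety}
    (h : (ltr 0 * ltr 0 * ltr 0 * ltr 1, ltr 0 * ltr 0 * ltr 0) ∈ Y.theory) :
    HasBase ZMvar Y := by
  intro W hW
  by_contra! hc
  obtain ⟨k, hk, hpow⟩ := exists_pow_mul_self hc.2
  refine hc.1 (isBottom_iff.2 fun S hS a b => ?_)
  have cube : ∀ x y : S.carrier, x * x * x * y = x * x * x := by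
    intro x y
    simpa [ltr] using hS _ (hW h) (fun n => if n = 0 then x else y)
  have key : ∀ x y : S.carrier, x * y = x := by
    intro x y
    obtain ⟨z, hz⟩ := exists_coe_eq_pow x (n := 3 * k + 1) (by omega)
    have hx : z = x := by
      apply WithOne.coe_injective
      rw [hz, show 3 * k + 1 = k + k + k + 1 by ring, pow_add, pow_add, pow_add, pow_one, mul_assoc,
        mul_assoc, hpow S hS, hpow S hS, hpow S hS]
    have hx3 : x * x * x = x := by
      obtain ⟨w, hw⟩ := exists_coe_eq_pow x (n := 3 * k - 2) (by omega)
      rw [← cube x w]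
      conv_rhs => rw [← hx]
      apply WithOne.coe_injective
      rw [hz, WithOne.coe_mul, WithOne.coe_mul, WithOne.coe_mul, hw,
        show 3 * k + 1 = 3 + (3 * k - 2) by omega, pow_add]
      simp [pow_succ]
    rw [← hx3, cube]
  rw [← key a b, mul_comm, key]

/-- The multiplication of the monogenic semigroup `{a, a ^ 2, 0}` with `a ^ 3 = 0`. -/
def cubeZeroMul (a b : Fin 3) : Fin 3 := if a = 1 ∧ b = 1 then 2 else 0

/-- The monogenic semigroup `{a, a ^ 2, 0}` with `a ^ 3 = 0`. -/
def cubeZeroSG : ComSG :=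
  { carrier := Fin 3
    str :=
      { mul := cubeZeroMul
        mul_assoc := (by decide : ∀ a b c, cubeZeroMul (cubeZeroMul a b) c =
          cubeZeroMul a (cubeZeroMul b c))
        mul_comm := (by decide : ∀ a b, cubeZeroMul a b = cubeZeroMul b a) } }

/-- Disjoint union of nonempty sets, extended by `∅` as a zero. -/
def disjointUnionMul (a b : Finset (Fin 3)) : Finset (Fin 3) :=
  if a ≠ ∅ ∧ b ≠ ∅ ∧ Disjoint a b then a ∪ b else ∅

theorem disjointUnionMul_assoc (a b c : Finset (Fin 3)) :
    disjointUnionMul (disjointUnionMul a b) c = disjointUnionMul a (disjointUnionMul b c) := by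
  revert a b c
  decide

/-- The nonempty subsets of a three-element set under disjoint union, with `∅` as zero. -/
def disjointUnionSG : ComSG :=
  { carrier := Finset (Fin 3)
    str :=
      { mul := disjointUnionMul
        mul_assoc := disjointUnionMul_assoc
        mul_comm := (by decide : ∀ a b, disjointUnionMul a b = disjointUnionMul b a) } }

theorem cubeZeroSG_triple (x y z w : cubeZeroSG.carrier) : x * y * z * w = x * y * z :=
  (by decide : ∀ x y z w, cubeZeroMul (cubeZeroMul (cubeZeroMul x y) z) w =
    cubeZeroMul (cubeZeroMul x y) z) x y z w

theorem disjointUnionSG_sq (x y : disjointUnionSG.carrier) : x * x * y = x * x :=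
  (by decide : ∀ x y, disjointUnionMul (disjointUnionMul x x) y = disjointUnionMul x x) x y

/-- The variety given by `xyz = 0`. -/
def tripleVar : ComVariety := comVar {(ltr 0 * ltr 1 * ltr 2 * ltr 3, ltr 0 * ltr 1 * ltr 2)}

/-- The variety given by `x ^ 2 = 0`. -/
def squareVar : ComVariety := comVar {(ltr 0 * ltr 0 * ltr 1, ltr 0 * ltr 0)}

theorem hasBase_ZMvar_tripleVar : HasBase ZMvar tripleVar := by
  refine hasBase_ZMvar_of_cube (mem_comVar.2 fun S hS f => ?_)
  have := hS _ (Set.mem_singleton _) (fun n => if n = 3 then f 1 else f 0)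
  simpa [ltr] using this

theorem hasBase_ZMvar_squareVar : HasBase ZMvar squareVar := by
  refine hasBase_ZMvar_of_cube (mem_comVar.2 fun S hS f => ?_)
  have h : ∀ y, f 0 * f 0 * y = f 0 * f 0 := fun y => by
    have := hS _ (Set.mem_singleton _) (fun n => if n = 1 then y else f 0)
    simpa [ltr] using this
  simp [ltr, h]

theorem hasBase_ZMvar_ZMvar : HasBase ZMvar ZMvar :=
  hasBase_ZMvar_of_cube (mem_ZMvar_of_length (by simp [letters_mul, letters_ltr])
    (by simp [letters_mul, letters_ltr]))

theorem not_tripleVar_le_squareVar : ¬ tripleVar ≤ squareVar := by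
  intro h
  have hm : cubeZeroSG ∈ modelsOf tripleVar.theory := by
    refine mem_models_comVar.2 ?_
    rintro i rfl f
    simp only [map_mul, cubeZeroSG_triple]
  have : cubeZeroMul (cubeZeroMul 1 1) 1 = cubeZeroMul 1 1 :=
    hm _ (h (subset_theoryOfClass_modelsOf _ (Set.mem_singleton _))) (fun _ => (1 : Fin 3))
  exact absurd this (by decide)

theorem not_squareVar_le_tripleVar : ¬ squareVar ≤ tripleVar := by
  intro h
  have hm : disjointUnionSG ∈ modelsOf squareVar.theory := by
    refine mem_models_comVar.2 ?_
    rintro i rfl f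
    simp only [map_mul, disjointUnionSG_sq]
  have : disjointUnionMul (disjointUnionMul (disjointUnionMul {0} {1}) {2}) {0} =
      disjointUnionMul (disjointUnionMul {0} {1}) {2} :=
    hm _ (h (subset_theoryOfClass_modelsOf _ (Set.mem_singleton _)))
      (fun n => ({(Fin.ofNat 3 n)} : Finset (Fin 3)))
  exact absurd this (by decide)

theorem hasGroupAtoms_iff (V : ComVariety) :
    HasGroupAtoms V ↔ (¬ SLvar ≤ V ∧ ¬ ZMvar ≤ V) := by
  constructor
  · intro h
    refine ⟨fun hle => ?_, fun hle => ?_⟩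
    · obtain ⟨⟨Y, hY, hn⟩, -⟩ := h SLvar hle not_isBottom_SLvar hasBase_SLvar_SLvar
      exact hn (le_SLvar_of_hasBase hY)
    · exact ((h ZMvar hle not_isBottom_ZMvar hasBase_ZMvar_ZMvar).2 _ hasBase_ZMvar_tripleVar _
        hasBase_ZMvar_squareVar).elim not_tripleVar_le_squareVar not_squareVar_le_tripleVar
  · rintro ⟨h1, h2⟩
    obtain ⟨n, hn, rfl⟩ := exists_eq_congrVar h1 h2
    exact hasGroupAtoms_congrVar hn

/-! ### The defining formula -/

/-- The formula `a ∨ b = b`. -/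
def leFormula {n : ℕ} (a b : Fin 1 ⊕ Fin n) : latticeLang.BoundedFormula (Fin 1) n :=
  Language.Term.bdEqual
    (Language.Term.func (L := latticeLang) (l := 2) true
      ![Language.Term.var a, Language.Term.var b])
    (Language.Term.var b)

/-- The formula expressing `IsBottom`. -/
def botFormula {n : ℕ} (i : Fin n) : latticeLang.BoundedFormula (Fin 1) n :=
  (leFormula (Sum.inr i.castSucc) (Sum.inr (Fin.last n))).all

/-- The formula expressing `HasBase`. -/
def baseFormula {n : ℕ} (i j : Fin n) : latticeLang.BoundedFormula (Fin 1) n :=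
  ((leFormula (Sum.inr (Fin.last n)) (Sum.inr j.castSucc)).imp
    (botFormula (Fin.last n) ⊔ leFormula (Sum.inr i.castSucc) (Sum.inr (Fin.last n)))).all

/-- The formula expressing `HasGroupAtoms`. -/
def groupAtomsFormula : latticeLang.Formula (Fin 1) :=
  ((leFormula (n := 1) (Sum.inr 0) (Sum.inl 0)).imp ((botFormula 0).not.imp ((baseFormula 0 0).imp
    ((baseFormula (n := 2) 0 1 ⊓ (leFormula (Sum.inr 1) (Sum.inr 0)).not).ex ⊓
      ((baseFormula (n := 2) 0 1).imp ((baseFormula (n := 3) 0 2).imp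
        (leFormula (Sum.inr 1) (Sum.inr 2) ⊔ leFormula (Sum.inr 2) (Sum.inr 1))).all).all)))).all

section Realize

variable {L : Type*} [Lattice L]

theorem realize_leFormula {n : ℕ} (a b : Fin 1 ⊕ Fin n) (v : Fin 1 → L) (xs : Fin n → L) :
    (leFormula a b).Realize v xs ↔ Sum.elim v xs a ≤ Sum.elim v xs b := by
  rw [← sup_eq_right]
  rfl

theorem realize_botFormula {n : ℕ} (i : Fin n) (v : Fin 1 → L) (xs : Fin n → L) :
    (botFormula i).Realize v xs ↔ IsBottom (xs i) := by
  simp [botFormula, realize_leFormula, IsBottom]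

theorem realize_baseFormula {n : ℕ} (i j : Fin n) (v : Fin 1 → L) (xs : Fin n → L) :
    (baseFormula i j).Realize v xs ↔ HasBase (xs i) (xs j) := by
  simp [baseFormula, realize_leFormula, realize_botFormula, HasBase]

theorem realize_groupAtomsFormula (a : L) :
    (groupAtomsFormula.Realize fun _ => a) ↔ HasGroupAtoms a := by
  simp [groupAtomsFormula, Language.Formula.Realize, realize_leFormula, realize_botFormula,
    realize_baseFormula, HasGroupAtoms, Fin.snoc]

end Realize

/-- **Theorem.** The set of all Abelian periodic group varieties is definable in the
lattice **Com**; moreover, a commutative semigroup variety is an (Abelian) periodic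
group variety if and only if it contains neither the variety `SL` of semilattices nor
the variety `ZM` of null semigroups.  (Every member of a commutative variety is
commutative, so "Abelian" is automatic here.) -/
theorem definable_periodic_group_varieties :
    LatDefinable ComVariety {V : ComVariety | IsGroupVariety V ∧ IsPeriodicVariety V} ∧
    (∀ V : ComVariety,
      (IsGroupVariety V ∧ IsPeriodicVariety V) ↔ (¬ SLvar ≤ V ∧ ¬ ZMvar ≤ V)) := by
  refine ⟨⟨groupAtomsFormula, fun V => ?_⟩, isGroupVariety_and_isPeriodicVariety_iff⟩
  rw [realize_groupAtomsFormula, hasGroupAtoms_iff]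
  exact (isGroupVariety_and_isPeriodicVariety_iff V).symm
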